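/- arXiv:2012.15069 — 12 statements merged into one kernel-verified Lean document; each statement's English description precedes it below -/
import Mathlib

section
/- The Kac–Wakimoto equation is invariant under the symmetry generated by X₅ = z f(t) ∂/∂u: for every smooth u : ℝ⁴ → ℝ and every smooth f : ℝ → ℝ, the function v(x,y,z,t) = u(x,y,z,t) + z·f(t) satisfies E[v](x,y,z,t) = E[u](x,y,z,t) for all (x,y,z,t); in particular, if E[u] = 0 everywhere then E[v] = 0 everywhere. -/
noncomputable section

/-- Partial derivative in the first coordinate `x`. -/
def pdx (u : ℝ → ℝ → ℝ → ℝ → ℝ) : ℝ → ℝ → ℝ → ℝ → ℝ :=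
  fun x y z t => deriv (fun s => u s y z t) x

/-- Partial derivative in the second coordinate `y`. -/
def pdy (u : ℝ → ℝ → ℝ → ℝ → ℝ) : ℝ → ℝ → ℝ → ℝ → ℝ :=
  fun x y z t => deriv (fun s => u x s z t) y

/-- Partial derivative in the third coordinate `z`. -/
def pdz (u : ℝ → ℝ → ℝ → ℝ → ℝ) : ℝ → ℝ → ℝ → ℝ → ℝ :=
  fun x y z t => deriv (fun s => u x y s t) z

/-- Partial derivative in the fourth coordinate `t`. -/
def pdt (u : ℝ → ℝ → ℝ → ℝ → ℝ) : ℝ → ℝ → ℝ → ℝ → ℝ :=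
  fun x y z t => deriv (fun s => u x y z s) t

/-- The Kac–Wakimoto operator `E[u]` with `a = −280√6`, `b = 210`, `c = −240√2`. -/
def KW (u : ℝ → ℝ → ℝ → ℝ → ℝ) : ℝ → ℝ → ℝ → ℝ → ℝ :=
  fun x y z t =>
    (pdx^[8] u) x y z t
    + 28 * pdx u x y z t * (pdx^[6] u) x y z t
    + 28 * (pdx^[2] u) x y z t * (pdx^[5] u) x y z t
    + 70 * (pdx^[3] u) x y z t * (pdx^[4] u) x y z t
    + 210 * (pdx u x y z t) ^ 2 * (pdx^[4] u) x y z t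
    + 420 * pdx u x y z t * (pdx^[2] u) x y z t * (pdx^[3] u) x y z t
    + 420 * (pdx u x y z t) ^ 3 * (pdx^[2] u) x y z t
    + (-280 * Real.sqrt 6) *
        ((pdx^[3] (pdy u)) x y z t + 3 * pdy u x y z t * (pdx^[2] u) x y z t
          + 3 * pdx u x y z t * (pdx (pdy u)) x y z t)
    + 210 * (pdz (pdz u)) x y z t
    + (-240 * Real.sqrt 2) * (pdt (pdx u)) x y z t

/-- Adding a function that does not depend on `x` leaves the `x`-derivative unchanged. -/
theorem pdx_add_of_const (u : ℝ → ℝ → ℝ → ℝ → ℝ) (g : ℝ → ℝ → ℝ → ℝ) :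
    pdx (fun x y z t => u x y z t + g y z t) = pdx u := by
  funext x y z t
  simp only [pdx, deriv_add_const]

/-- Adding a function that does not depend on `y` leaves the `y`-derivative unchanged. -/
theorem pdy_add_of_const (u : ℝ → ℝ → ℝ → ℝ → ℝ) (g : ℝ → ℝ → ℝ → ℝ) :
    pdy (fun x y z t => u x y z t + g x z t) = pdy u := by
  funext x y z t
  simp only [pdy, deriv_add_const]

/-- Adding a function that does not depend on `z` leaves the `z`-derivative unchanged. -/
theorem pdz_add_of_const (u : ℝ → ℝ → ℝ → ℝ → ℝ) (g : ℝ → ℝ → ℝ → ℝ) :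
    pdz (fun x y z t => u x y z t + g x y t) = pdz u := by
  funext x y z t
  simp only [pdz, deriv_add_const]

/-- The `z`-derivative of `u + z f(t)` is `u_z + f(t)`. -/
theorem pdz_add_mul (u : ℝ → ℝ → ℝ → ℝ → ℝ)
    (hu : ∀ x y z t, DifferentiableAt ℝ (fun s => u x y s t) z) (f : ℝ → ℝ) :
    pdz (fun x y z t => u x y z t + z * f t) = fun x y z t => pdz u x y z t + f t := by
  funext x y z t
  simpa [pdz] using
    ((hu x y z t).hasDerivAt.fun_add ((hasDerivAt_id z).mul_const (f t))).deriv

/-- The Kac–Wakimoto equation is invariant under the symmetry `X₅ = z f(t) ∂/∂u`: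
adding `z·f(t)` to a solution leaves `E[u]` unchanged. -/
theorem kw_X5_invariance (u : ℝ → ℝ → ℝ → ℝ → ℝ)
    (hu : ContDiff ℝ (⊤ : ℕ∞) (fun p : ℝ × ℝ × ℝ × ℝ => u p.1 p.2.1 p.2.2.1 p.2.2.2))
    (f : ℝ → ℝ) (hf : ContDiff ℝ (⊤ : ℕ∞) f) :
    (∀ x y z t : ℝ, KW (fun x y z t => u x y z t + z * f t) x y z t = KW u x y z t) ∧
    ((∀ x y z t : ℝ, KW u x y z t = 0) →
      ∀ x y z t : ℝ, KW (fun x y z t => u x y z t + z * f t) x y z t = 0) := by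
  have hz : ∀ x y z t, DifferentiableAt ℝ (fun s => u x y s t) z := fun x y z t =>
    ((hu.differentiable (by simp)).comp
      (by fun_prop : Differentiable ℝ fun s : ℝ => (x, y, s, t))).differentiableAt
  have key : ∀ x y z t : ℝ,
      KW (fun x y z t => u x y z t + z * f t) x y z t = KW u x y z t := by
    intro x y z t
    have hx := pdx_add_of_const u fun _ z t => z * f t
    have hy := pdy_add_of_const u fun _ z t => z * f t
    have hzz := pdz_add_of_const (pdz u) fun _ _ t => f t
    simp only [KW, Function.iterate_succ_apply, Function.iterate_zero_apply, hx, hy,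
      pdz_add_mul u hz f, hzz]
  exact ⟨key, fun h x y z t => (key x y z t).trans (h x y z t)⟩

end
end

section
/- For every smooth f : ℝ → ℝ, the Lie brackets of X₁ with the remaining symmetry generators are: [X₁, X₃(f)] = X₃(f′), [X₁, X₄(f)] = X₄(f′), [X₁, X₅(f)] = X₅(f′), and [X₁, X₆(f)] = X₆(f′), as identities of vector fields on ℝ⁵. -/
noncomputable section

/-- Points of ℝ⁵ with coordinates `(x, y, z, t, u)`. -/
abbrev P5 : Type := ℝ × ℝ × ℝ × ℝ × ℝ

/-- Lie bracket of vector fields on ℝ⁵, identified with smooth maps `V : ℝ⁵ → ℝ⁵`: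
`[V,W](p) = DW(p)(V(p)) − DV(p)(W(p))`. -/
def vbracket (V W : P5 → P5) : P5 → P5 :=
  fun p => fderiv ℝ W p (V p) - fderiv ℝ V p (W p)

/-- `X₁ = ∂/∂t`. -/
def X1 : P5 → P5 := fun _ => (0, 0, 0, 1, 0)

/-- `X₂ = ∂/∂y`. -/
def X2 : P5 → P5 := fun _ => (0, 1, 0, 0, 0)

/-- `X₃(f) = −(1/2) z f′(t) ∂/∂x + f(t) ∂/∂z − (1/6) y z f″(t) ∂/∂u`. -/
def X3 (f : ℝ → ℝ) : P5 → P5 :=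
  fun p => (-(1 / 2) * p.2.2.1 * deriv f p.2.2.2.1, 0, f p.2.2.2.1, 0,
    -(1 / 6) * p.2.1 * p.2.2.1 * deriv (deriv f) p.2.2.2.1)

/-- `X₄(f) = f(t) ∂/∂x + (1/3) y f′(t) ∂/∂u`. -/
def X4 (f : ℝ → ℝ) : P5 → P5 :=
  fun p => (f p.2.2.2.1, 0, 0, 0, (1 / 3) * p.2.1 * deriv f p.2.2.2.1)

/-- `X₅(f) = z f(t) ∂/∂u`. -/
def X5 (f : ℝ → ℝ) : P5 → P5 :=
  fun p => (0, 0, 0, 0, p.2.2.1 * f p.2.2.2.1)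

/-- `X₆(f) = f(t) ∂/∂u`. -/
def X6 (f : ℝ → ℝ) : P5 → P5 :=
  fun p => (0, 0, 0, 0, f p.2.2.2.1)

/-- The bracket with `∂/∂t` is the partial derivative in `t`. -/
theorem vbracket_X1_eq {W W' : P5 → P5} (hW : Differentiable ℝ W)
    (h : ∀ x y z t u : ℝ, HasDerivAt (fun s : ℝ => W (x, y, z, s, u)) (W' (x, y, z, t, u)) t) :
    vbracket X1 W = W' := by
  funext ⟨x, y, z, t, u⟩
  have hc : HasDerivAt (fun s : ℝ => ((x, y, z, s, u) : P5)) (0, 0, 0, 1, 0) t :=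
    (hasDerivAt_const t x).prodMk ((hasDerivAt_const t y).prodMk ((hasDerivAt_const t z).prodMk
      ((hasDerivAt_id t).prodMk (hasDerivAt_const t u))))
  have hX : fderiv ℝ X1 (x, y, z, t, u) = 0 :=
    (hasFDerivAt_const ((0, 0, 0, 1, 0) : P5) _).fderiv
  have hcomp := (hW (x, y, z, t, u)).hasFDerivAt.comp_hasDerivAt t hc
  simp only [vbracket, hX, zero_apply, sub_zero]
  exact hcomp.unique (h x y z t u)

/-- Lie brackets of `X₁` with the remaining symmetry generators:
`[X₁, X₃(f)] = X₃(f′)`, `[X₁, X₄(f)] = X₄(f′)`, `[X₁, X₅(f)] = X₅(f′)`,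
`[X₁, X₆(f)] = X₆(f′)`. -/
theorem brackets_with_X1 (f : ℝ → ℝ) (hf : ContDiff ℝ (⊤ : ℕ∞) f) :
    vbracket X1 (X3 f) = X3 (deriv f) ∧
    vbracket X1 (X4 f) = X4 (deriv f) ∧
    vbracket X1 (X5 f) = X5 (deriv f) ∧
    vbracket X1 (X6 f) = X6 (deriv f) := by
  have hsmooth : ∀ {g : ℝ → ℝ}, ContDiff ℝ (⊤ : ℕ∞) g → ContDiff ℝ (⊤ : ℕ∞) (deriv g) :=
    fun hg => (contDiff_infty_iff_deriv.mp hg).2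
  have d0 : Differentiable ℝ f := hf.differentiable (by simp)
  have d1 : Differentiable ℝ (deriv f) := (hsmooth hf).differentiable (by simp)
  have d2 : Differentiable ℝ (deriv (deriv f)) :=
    (hsmooth (hsmooth hf)).differentiable (by simp)
  refine ⟨vbracket_X1_eq (by unfold X3; fun_prop) fun x y z t u => ?_,
    vbracket_X1_eq (by unfold X4; fun_prop) fun x y z t u => ?_,
    vbracket_X1_eq (by unfold X5; fun_prop) fun x y z t u => ?_,
    vbracket_X1_eq (by unfold X6; fun_prop) fun x y z t u => ?_⟩
  · exact ((d1 t).hasDerivAt.const_mul (-(1 / 2) * z)).prodMk ((hasDerivAt_const t (0 : ℝ)).prodMk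
      ((d0 t).hasDerivAt.prodMk ((hasDerivAt_const t (0 : ℝ)).prodMk
        ((d2 t).hasDerivAt.const_mul (-(1 / 6) * y * z)))))
  · exact (d0 t).hasDerivAt.prodMk ((hasDerivAt_const t (0 : ℝ)).prodMk
      ((hasDerivAt_const t (0 : ℝ)).prodMk ((hasDerivAt_const t (0 : ℝ)).prodMk
        ((d1 t).hasDerivAt.const_mul (1 / 3 * y)))))
  · exact (hasDerivAt_const t (0 : ℝ)).prodMk ((hasDerivAt_const t (0 : ℝ)).prodMk
      ((hasDerivAt_const t (0 : ℝ)).prodMk ((hasDerivAt_const t (0 : ℝ)).prodMk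
        ((d0 t).hasDerivAt.const_mul z))))
  · exact (hasDerivAt_const t (0 : ℝ)).prodMk ((hasDerivAt_const t (0 : ℝ)).prodMk
      ((hasDerivAt_const t (0 : ℝ)).prodMk ((hasDerivAt_const t (0 : ℝ)).prodMk (d0 t).hasDerivAt)))

end
end

section
/- For every smooth f : ℝ → ℝ, the Lie brackets of X₂ with X₃(f) and X₄(f) are: [X₂, X₃(f)] = −X₅((1/6) f″) and [X₂, X₄(f)] = X₆((1/3) f′), as identities of vector fields on ℝ⁵. -/
noncomputable section

/-- If a differentiable function is affine along the line through `p` in direction `v`,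
its derivative at `p` in that direction is the slope. -/
lemma fderiv_apply_eq_of_affine_along {E F : Type*} [NormedAddCommGroup E] [NormedSpace ℝ E]
    [NormedAddCommGroup F] [NormedSpace ℝ F] {W : E → F} {p v : E} {c : F}
    (hW : DifferentiableAt ℝ W p) (h : ∀ s : ℝ, W (p + s • v) = W p + s • c) :
    fderiv ℝ W p v = c := by
  have h_line : HasLineDerivAt ℝ W c p v := by
    simpa [HasLineDerivAt, h] using ((hasDerivAt_id (0 : ℝ)).smul_const c).const_add (W p)
  rw [← hW.lineDeriv_eq_fderiv, h_line.lineDeriv]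

lemma vbracket_X2 (W : P5 → P5) : vbracket X2 W = fun p => fderiv ℝ W p (0, 1, 0, 0, 0) := by
  funext p
  have h : fderiv ℝ X2 p = 0 := (hasFDerivAt_const _ p).fderiv
  simp [vbracket, h, X2]

/-- Lie brackets of `X₂` with `X₃(f)` and `X₄(f)`:
`[X₂, X₃(f)] = −X₅((1/6) f″)` and `[X₂, X₄(f)] = X₆((1/3) f′)`. -/
theorem brackets_with_X2 (f : ℝ → ℝ) (hf : ContDiff ℝ (⊤ : ℕ∞) f) :
    vbracket X2 (X3 f) = -(X5 (fun t => (1 / 6) * deriv (deriv f) t)) ∧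
    vbracket X2 (X4 f) = X6 (fun t => (1 / 3) * deriv f t) := by
  have hf₁ : ContDiff ℝ (⊤ : ℕ∞) (deriv f) := (contDiff_infty_iff_deriv.mp hf).2
  have hf₂ : ContDiff ℝ (⊤ : ℕ∞) (deriv (deriv f)) := (contDiff_infty_iff_deriv.mp hf₁).2
  have d₀ : Differentiable ℝ f := hf.differentiable (by simp)
  have d₁ : Differentiable ℝ (deriv f) := hf₁.differentiable (by simp)
  have d₂ : Differentiable ℝ (deriv (deriv f)) := hf₂.differentiable (by simp)
  rw [vbracket_X2, vbracket_X2]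
  constructor <;> funext p <;> apply fderiv_apply_eq_of_affine_along
  · unfold X3
    fun_prop
  · intro s
    simp only [X3, X5, Pi.neg_apply]
    ext <;> simp
    ring
  · unfold X4
    fun_prop
  · intro s
    simp only [X4, X6]
    ext <;> simp
    ring

end
end

section
/- For all smooth f, g : ℝ → ℝ, the Lie bracket of X₃(f) and X₅(g) is [X₃(f), X₅(g)] = X₆(f·g), where (f·g)(t) = f(t)g(t), as an identity of vector fields on ℝ⁵. -/
noncomputable section

/-- Lie bracket `[X₃(f), X₅(g)] = X₆(f·g)`. -/
theorem bracket_X3_X5 (f g : ℝ → ℝ) (hf : ContDiff ℝ (⊤ : ℕ∞) f) (hg : ContDiff ℝ (⊤ : ℕ∞) g) :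
    vbracket (X3 f) (X5 g) = X6 (fun t => f t * g t) := by
  funext p
  have hf' : ContDiff ℝ (⊤ : ℕ∞) (deriv f) := (contDiff_infty_iff_deriv.1 hf).2
  have df := (contDiff_infty_iff_deriv.1 hf).1
  have df' := (contDiff_infty_iff_deriv.1 hf').1
  have df'' := (contDiff_infty_iff_deriv.1 (contDiff_infty_iff_deriv.1 hf').2).1
  have dg := (contDiff_infty_iff_deriv.1 hg).1
  have h3 : DifferentiableAt ℝ (X3 f) p := by unfold X3; fun_prop
  have h5 : DifferentiableAt ℝ (X5 g) p := by unfold X5; fun_prop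
  have e3 : fderiv ℝ (X3 f) p (X5 g p) = 0 := by
    rw [← h3.lineDeriv_eq_fderiv]
    simp [lineDeriv, X3, X5]
  have e5 : fderiv ℝ (X5 g) p (X3 f p) = X6 (fun t => f t * g t) p := by
    rw [← h5.lineDeriv_eq_fderiv]
    refine HasDerivAt.deriv ?_
    simp only [X3, X5, X6, Prod.fst_add, Prod.snd_add, Prod.smul_fst, Prod.smul_snd, smul_eq_mul,
      mul_zero, add_zero]
    have hu : HasDerivAt (fun s : ℝ => (p.2.2.1 + s * f p.2.2.2.1) * g p.2.2.2.1)
        (f p.2.2.2.1 * g p.2.2.2.1) 0 := by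
      simpa using (((hasDerivAt_id (0 : ℝ)).mul_const (f p.2.2.2.1)).const_add
        p.2.2.1).mul_const (g p.2.2.2.1)
    have h0 := hasDerivAt_const (0 : ℝ) (0 : ℝ)
    exact h0.prodMk (h0.prodMk (h0.prodMk (h0.prodMk hu)))
  rw [vbracket, e3, e5, sub_zero]

end
end

section
/- For all smooth f, g : ℝ → ℝ, the following Lie brackets of symmetry generators vanish identically: [X₃(f), X₄(g)] = 0, [X₃(f), X₆(g)] = 0, [X₄(f), X₅(g)] = 0, [X₄(f), X₆(g)] = 0, [X₅(f), X₆(g)] = 0, [X₂, X₅(f)] = 0, and [X₂, X₆(f)] = 0, as identities of vector fields on ℝ⁵. -/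
noncomputable section

/-- The derivative of a map vanishes in every direction along which the map is constant. -/
theorem fderiv_apply_eq_zero_of_forall_add_smul {E F : Type*} [NormedAddCommGroup E]
    [NormedSpace ℝ E] [NormedAddCommGroup F] [NormedSpace ℝ F] {V : E → F} {p v : E}
    (h : ∀ s : ℝ, V (p + s • v) = V p) : fderiv ℝ V p v = 0 := by
  by_cases hV : DifferentiableAt ℝ V p
  · rw [← hV.lineDeriv_eq_fderiv, lineDeriv]
    simp only [h, deriv_const]
  · simp [fderiv_zero_of_not_differentiableAt hV]

/-- Two vector fields, each constant along the directions of the other, commute. -/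
theorem vbracket_eq_zero_of_forall_add_smul {V W : P5 → P5}
    (hW : ∀ p, ∀ s : ℝ, W (p + s • V p) = W p) (hV : ∀ p, ∀ s : ℝ, V (p + s • W p) = V p) :
    vbracket V W = 0 := by
  funext p
  simp [vbracket, fderiv_apply_eq_zero_of_forall_add_smul (hW p),
    fderiv_apply_eq_zero_of_forall_add_smul (hV p)]

/-- Vanishing Lie brackets among the symmetry generators:
`[X₃(f), X₄(g)] = 0`, `[X₃(f), X₆(g)] = 0`, `[X₄(f), X₅(g)] = 0`, `[X₄(f), X₆(g)] = 0`,
`[X₅(f), X₆(g)] = 0`, `[X₂, X₅(f)] = 0`, and `[X₂, X₆(f)] = 0`. -/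
theorem vanishing_brackets (f g : ℝ → ℝ) (hf : ContDiff ℝ (⊤ : ℕ∞) f) (hg : ContDiff ℝ (⊤ : ℕ∞) g) :
    vbracket (X3 f) (X4 g) = 0 ∧
    vbracket (X3 f) (X6 g) = 0 ∧
    vbracket (X4 f) (X5 g) = 0 ∧
    vbracket (X4 f) (X6 g) = 0 ∧
    vbracket (X5 f) (X6 g) = 0 ∧
    vbracket X2 (X5 f) = 0 ∧
    vbracket X2 (X6 f) = 0 := by
  refine ⟨?_, ?_, ?_, ?_, ?_, ?_, ?_⟩ <;>
    apply vbracket_eq_zero_of_forall_add_smul <;> intro p s <;>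
    simp [X2, X3, X4, X5, X6]

end
end

section
/- Let φ : ℝ⁶ → ℝ be differentiable, with coordinates (a₁,…,a₆), and suppose that at every point of ℝ⁶ it satisfies the system: ∂φ/∂a₆ = 0; a₁ ∂φ/∂a₄ + a₂ ∂φ/∂a₆ = 0; a₁ ∂φ/∂a₅ + a₃ ∂φ/∂a₆ = 0; a₃ ∂φ/∂a₅ − a₄ ∂φ/∂a₆ = 0; a₁ ∂φ/∂a₃ − a₂ ∂φ/∂a₅ − a₅ ∂φ/∂a₆ = 0; a₃ ∂φ/∂a₃ + a₄ ∂φ/∂a₄ + a₅ ∂φ/∂a₅ + a₆ ∂φ/∂a₆ = 0. Then at every point p ∈ ℝ⁶ with a₁ ≠ 0, all four partial derivatives ∂φ/∂a₃, ∂φ/∂a₄, ∂φ/∂a₅, ∂φ/∂a₆ vanish at p; hence on the region a₁ ≠ 0, φ is a function of a₁ and a₂ only. -/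
/-- The `i`-th partial derivative of `φ : ℝ⁶ → ℝ` at `p`. -/
noncomputable def pd (φ : (Fin 6 → ℝ) → ℝ) (i : Fin 6) (p : Fin 6 → ℝ) : ℝ :=
  fderiv ℝ φ p (Pi.single i 1)

/-- A Fréchet derivative on `ℝ⁶` is the sum of the partial derivatives weighted by the
coordinates of the direction. -/
lemma fderiv_eq_sum_pd (φ : (Fin 6 → ℝ) → ℝ) (p v : Fin 6 → ℝ) :
    fderiv ℝ φ p v = ∑ i, v i * pd φ i p := by
  conv_lhs => rw [pi_eq_sum_univ' v, map_sum]
  simp only [map_smul, smul_eq_mul, pd]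

/-- A differentiable function whose derivative in the direction `q - p` vanishes along the line
through `p` and `q` takes the same value at `p` and `q`. -/
lemma eq_of_fderiv_sub_eq_zero {E : Type*} [NormedAddCommGroup E] [NormedSpace ℝ E]
    {f : E → ℝ} (hf : Differentiable ℝ f) (p q : E)
    (h : ∀ t : ℝ, fderiv ℝ f (p + t • (q - p)) (q - p) = 0) : f p = f q := by
  have hg : ∀ t : ℝ, HasDerivAt (fun t : ℝ => f (p + t • (q - p))) 0 t := by
    intro t
    have hline : HasDerivAt (fun t : ℝ => p + t • (q - p)) (q - p) t := by
      simpa using ((hasDerivAt_id t).smul_const (q - p)).const_add p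
    simpa [h t, Function.comp_def] using
      (hf (p + t • (q - p))).hasFDerivAt.comp_hasDerivAt t hline
  simpa using is_const_of_deriv_eq_zero (fun t => (hg t).differentiableAt)
    (fun t => (hg t).deriv) 0 1

/-- If a differentiable `φ : ℝ⁶ → ℝ` (coordinates `(a₁,…,a₆)`, here `aᵢ = p (i−1)`)
satisfies the invariance system
`∂φ/∂a₆ = 0`, `a₁ ∂φ/∂a₄ + a₂ ∂φ/∂a₆ = 0`, `a₁ ∂φ/∂a₅ + a₃ ∂φ/∂a₆ = 0`,
`a₃ ∂φ/∂a₅ − a₄ ∂φ/∂a₆ = 0`, `a₁ ∂φ/∂a₃ − a₂ ∂φ/∂a₅ − a₅ ∂φ/∂a₆ = 0`,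
`a₃ ∂φ/∂a₃ + a₄ ∂φ/∂a₄ + a₅ ∂φ/∂a₅ + a₆ ∂φ/∂a₆ = 0`
at every point, then at every point with `a₁ ≠ 0` the partials `∂φ/∂a₃`, `∂φ/∂a₄`,
`∂φ/∂a₅`, `∂φ/∂a₆` vanish; hence on the region `a₁ ≠ 0`, `φ` depends only on `a₁, a₂`. -/
theorem invariant_function_depends_only_on_a1_a2
    (φ : (Fin 6 → ℝ) → ℝ) (hφ : Differentiable ℝ φ)
    (h1 : ∀ p : Fin 6 → ℝ, pd φ 5 p = 0)
    (h2 : ∀ p : Fin 6 → ℝ, p 0 * pd φ 3 p + p 1 * pd φ 5 p = 0)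
    (h3 : ∀ p : Fin 6 → ℝ, p 0 * pd φ 4 p + p 2 * pd φ 5 p = 0)
    (h4 : ∀ p : Fin 6 → ℝ, p 2 * pd φ 4 p - p 3 * pd φ 5 p = 0)
    (h5 : ∀ p : Fin 6 → ℝ, p 0 * pd φ 2 p - p 1 * pd φ 4 p - p 4 * pd φ 5 p = 0)
    (h6 : ∀ p : Fin 6 → ℝ,
      p 2 * pd φ 2 p + p 3 * pd φ 3 p + p 4 * pd φ 4 p + p 5 * pd φ 5 p = 0) :
    (∀ p : Fin 6 → ℝ, p 0 ≠ 0 →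
      pd φ 2 p = 0 ∧ pd φ 3 p = 0 ∧ pd φ 4 p = 0 ∧ pd φ 5 p = 0) ∧
    (∀ p q : Fin 6 → ℝ, p 0 ≠ 0 → p 0 = q 0 → p 1 = q 1 → φ p = φ q) := by
  have hzero : ∀ p : Fin 6 → ℝ, p 0 ≠ 0 →
      pd φ 2 p = 0 ∧ pd φ 3 p = 0 ∧ pd φ 4 p = 0 ∧ pd φ 5 p = 0 := by
    intro p hp
    have e5 := h1 p
    have e3 : pd φ 3 p = 0 := by simpa [e5, hp] using h2 p
    have e4 : pd φ 4 p = 0 := by simpa [e5, hp] using h3 p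
    have e2 : pd φ 2 p = 0 := by simpa [e4, e5, hp] using h5 p
    exact ⟨e2, e3, e4, e5⟩
  refine ⟨hzero, fun p q hp h0 h1' => eq_of_fderiv_sub_eq_zero hφ p q fun t => ?_⟩
  obtain ⟨e2, e3, e4, e5⟩ := hzero (p + t • (q - p)) (by simpa [← h0] using hp)
  rw [fderiv_eq_sum_pd]
  simp [Fin.sum_univ_six, e2, e3, e4, e5, h0, h1']
end

section
/- Let (a₁,…,a₆) ∈ ℝ⁶ with a₁ ≠ 0. Then there exist ε₂, ε₃, ε₄, ε₅, ε₆ ∈ ℝ such that, with ε₁ = 0, the transformed coefficients under the full adjoint action satisfy ã₁ = a₁, ã₂ = a₂, and ã₃ = ã₄ = ã₅ = ã₆ = 0. Consequently every element of the symmetry algebra with a₁ ≠ 0 is equivalent under the adjoint action to a₁X₁ + a₂X₂. -/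
/-- The full adjoint action on coefficient vectors of the symmetry algebra:
`Φ(ε; a) = (ã₁, …, ã₆)` with
`ã₁ = a₁`, `ã₂ = a₂`, `ã₃ = (a₁ε₃ + a₃)e^{−ε₁}`, `ã₄ = (a₁ε₄ + a₄)e^{−ε₁}`,
`ã₅ = a₁ε₅ − e^{−ε₁}a₂ε₃ + e^{−ε₁}a₃ε₂ + e^{−ε₁}a₅`,
`ã₆ = a₁ε₃ε₅e^{−ε₁} + a₁ε₆ + (1/2)a₂ε₃²e^{−ε₁} − a₃ε₂ε₃e^{−ε₁} + a₃ε₅e^{−ε₁}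
      + a₂ε₄e^{−ε₁} − a₄ε₂e^{−ε₁} − a₅ε₃e^{−ε₁} + a₆e^{−ε₁}`. -/
noncomputable def adjAction (e1 e2 e3 e4 e5 e6 a1 a2 a3 a4 a5 a6 : ℝ) :
    ℝ × ℝ × ℝ × ℝ × ℝ × ℝ :=
  (a1,
   a2,
   (a1 * e3 + a3) * Real.exp (-e1),
   (a1 * e4 + a4) * Real.exp (-e1),
   a1 * e5 - Real.exp (-e1) * a2 * e3 + Real.exp (-e1) * a3 * e2 + Real.exp (-e1) * a5,
   a1 * e3 * e5 * Real.exp (-e1) + a1 * e6 + (1 / 2) * a2 * e3 ^ 2 * Real.exp (-e1)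
     - a3 * e2 * e3 * Real.exp (-e1) + a3 * e5 * Real.exp (-e1) + a2 * e4 * Real.exp (-e1)
     - a4 * e2 * Real.exp (-e1) - a5 * e3 * Real.exp (-e1) + a6 * Real.exp (-e1))

/-- Every element of the symmetry algebra with `a₁ ≠ 0` can be brought, by the full
adjoint action with `ε₁ = 0`, to the form with `ã₁ = a₁`, `ã₂ = a₂`, and
`ã₃ = ã₄ = ã₅ = ã₆ = 0`; i.e. it is equivalent to `a₁X₁ + a₂X₂`. -/
theorem adjoint_normal_form_a1_ne_zero (a1 a2 a3 a4 a5 a6 : ℝ) (h : a1 ≠ 0) :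
    ∃ e2 e3 e4 e5 e6 : ℝ,
      adjAction 0 e2 e3 e4 e5 e6 a1 a2 a3 a4 a5 a6 = (a1, a2, 0, 0, 0, 0) := by
  refine ⟨0, -a3 / a1, -a4 / a1, (a2 * (-a3 / a1) - a5) / a1,
    -((1 / 2) * a2 * (-a3 / a1) ^ 2 + a2 * (-a4 / a1) - a5 * (-a3 / a1) + a6) / a1, ?_⟩
  simp only [adjAction, neg_zero, Real.exp_zero, Prod.mk.injEq, true_and]
  refine ⟨?_, ?_, ?_, ?_⟩ <;> field_simp <;> ring
end

section
/- Let (a₁,…,a₆) ∈ ℝ⁶ with a₁ = 0, a₂ ≠ 0, and a₃ ≠ 0. Then there exist ε₁, …, ε₆ ∈ ℝ, a sign σ ∈ {−1, 1}, and β ∈ ℝ such that the transformed coefficients under the full adjoint action are (ã₁, ã₂, ã₃, ã₄, ã₅, ã₆) = (0, a₂, σ|a₂|, β, 0, 0). Consequently every such element is equivalent, up to an overall nonzero scalar, to X₂ ± X₃ + β′X₄ for some β′ ∈ ℝ. -/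
/-- If `a₁ = 0`, `a₂ ≠ 0` and `a₃ ≠ 0`, the full adjoint action brings the element
to the form `(0, a₂, σ|a₂|, β, 0, 0)` for some sign `σ ∈ {−1, 1}` and some `β ∈ ℝ`;
i.e. up to an overall nonzero scalar it is equivalent to `X₂ ± X₃ + β′X₄`. -/
theorem adjoint_normal_form_a1_zero_a2_a3_ne_zero (a2 a3 a4 a5 a6 : ℝ)
    (h2 : a2 ≠ 0) (h3 : a3 ≠ 0) :
    ∃ e1 e2 e3 e4 e5 e6 σ β : ℝ, (σ = 1 ∨ σ = -1) ∧
      adjAction e1 e2 e3 e4 e5 e6 0 a2 a3 a4 a5 a6 = (0, a2, σ * |a2|, β, 0, 0) := by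
  have hexp : Real.exp (-Real.log (|a3| / |a2|)) = |a2| / |a3| := by
    rw [Real.exp_neg, Real.exp_log (by positivity), inv_div]
  refine ⟨Real.log (|a3| / |a2|), -a5 / a3, 0, 0, (a4 * (-a5 / a3) - a6) / a3, 0,
    a3 / |a3|, a4 * (|a2| / |a3|), ?_, ?_⟩
  · rcases abs_choice a3 with h | h <;> simp [h, h3]
  · simp only [adjAction, hexp, Prod.mk.injEq, true_and]
    refine ⟨by ring, by ring, ?_, ?_⟩ <;> field_simp <;> ring
end

section
/- For every c ∈ ℝ, the function u(x,y,z,t) = c/x satisfies E[u](x,y,z,t) = −840·c·(c−2)(c−4)(c−6)·x^{−9} at every point with x ≠ 0. In particular, the three leading-order Painlevé branches u = 2/x, u = 4/x and u = 6/x are exact solutions of the Kac–Wakimoto equation E[u] = 0 on the region x ≠ 0, and no other nonzero constant c yields a solution of this form. -/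
noncomputable section

theorem pdx_mul_zpow (a : ℝ) (m : ℤ) :
    pdx (fun x _ _ _ => a * x ^ m) = fun x _ _ _ => a * m * x ^ (m - 1) := by
  funext x y z t
  simp only [pdx, deriv_const_mul_field, deriv_zpow]
  ring

theorem pdx_iterate_const_div (c : ℝ) (k : ℕ) :
    pdx^[k] (fun x _ _ _ => c / x)
      = fun x _ _ _ => c * (-1) ^ k * (k.factorial : ℝ) * x ^ (-(k : ℤ) - 1) := by
  induction k with
  | zero =>
    funext x y z t
    simp [div_eq_mul_inv]
  | succ k ih =>
    rw [Function.iterate_succ_apply', ih, pdx_mul_zpow]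
    funext x y z t
    rw [Nat.factorial_succ, show -(k : ℤ) - 1 - 1 = -((k + 1 : ℕ) : ℤ) - 1 by push_cast; ring]
    push_cast
    ring

theorem pdx_iterate_zero (k : ℕ) : pdx^[k] (fun _ _ _ _ => 0) = fun _ _ _ _ => 0 :=
  Function.iterate_fixed (by funext x y z t; simp [pdx]) k

theorem KW_const_div (c x y z t : ℝ) (hx : x ≠ 0) :
    KW (fun x _ _ _ => c / x) x y z t
      = -840 * c * (c - 2) * (c - 4) * (c - 6) / x ^ 9 := by
  have hpdx : pdx (fun x _ _ _ => c / x) = fun x _ _ _ => c * (-1) * x ^ (-2 : ℤ) := by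
    simpa using pdx_iterate_const_div c 1
  have hpdy : pdy (fun x _ _ _ => c / x) = fun _ _ _ _ => 0 := by
    funext x y z t; simp [pdy]
  have hpdz : pdz (pdz (fun x _ _ _ => c / x)) = fun _ _ _ _ => 0 := by
    funext x y z t; simp [pdz]
  have hpdt : pdt (fun x _ _ _ => c * (-1) * x ^ (-2 : ℤ)) = fun _ _ _ _ => 0 := by
    funext x y z t; simp [pdt]
  have hzero : pdx (fun _ _ _ _ => 0) = fun _ _ _ _ => 0 := pdx_iterate_zero 1
  simp only [KW, hpdt, hpdz, hpdy, hzero, pdx_iterate_zero, hpdx, pdx_iterate_const_div]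
  norm_num [Nat.factorial, zpow_neg]
  norm_cast
  field_simp
  ring

/-- For `u(x,y,z,t) = c/x` one has
`E[u] = −840·c·(c−2)(c−4)(c−6)·x⁻⁹` wherever `x ≠ 0`; in particular the Painlevé
leading-order branches `u = 2/x`, `u = 4/x`, `u = 6/x` solve the Kac–Wakimoto
equation on `x ≠ 0`, and no other nonzero constant `c` yields such a solution. -/
theorem kw_leading_order_branches :
    (∀ c x y z t : ℝ, x ≠ 0 →
      KW (fun x _ _ _ => c / x) x y z t
        = -840 * c * (c - 2) * (c - 4) * (c - 6) / x ^ 9) ∧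
    (∀ c : ℝ, c ≠ 0 →
      ((∀ x y z t : ℝ, x ≠ 0 → KW (fun x _ _ _ => c / x) x y z t = 0) ↔
        (c = 2 ∨ c = 4 ∨ c = 6))) := by
  refine ⟨KW_const_div, fun c hc => ⟨fun h => ?_, fun h x y z t hx => ?_⟩⟩
  · have h1 := h 1 0 0 0 one_ne_zero
    rw [KW_const_div c 1 0 0 0 one_ne_zero] at h1
    simpa [hc, sub_eq_zero, or_assoc] using h1
  · rw [KW_const_div c x y z t hx]
    rcases h with rfl | rfl | rfl <;> simp

end
end

section
/- First Painlevé branch resonances: for every j ∈ ℝ and every x > 0, the derivative at s = 0 of the map s ↦ F₀[ξ ↦ 2/ξ + s·ξ^{j−1}](x) equals R₁(j)·x^{j−9}, where R₁(j) = (j+1)(j−1)(j−2)(j−3)(j−4)(j−5)(j−8)(j−14). In particular the resonance points of the branch with leading coefficient u₀ = 2φₓ are exactly j = −1, 1, 2, 3, 4, 5, 8, 14. -/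
noncomputable section

/-- The purely `x`-dependent part of the Kac–Wakimoto operator:
`F₀[v] = v⁽⁸⁾ + 28 v′v⁽⁶⁾ + 28 v″v⁽⁵⁾ + 70 v‴v⁽⁴⁾ + 210 (v′)² v⁽⁴⁾
        + 420 v′v″v‴ + 420 (v′)³ v″`. -/
def F0 (v : ℝ → ℝ) : ℝ → ℝ := fun x =>
  iteratedDeriv 8 v x
  + 28 * deriv v x * iteratedDeriv 6 v x
  + 28 * iteratedDeriv 2 v x * iteratedDeriv 5 v x
  + 70 * iteratedDeriv 3 v x * iteratedDeriv 4 v x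
  + 210 * (deriv v x) ^ 2 * iteratedDeriv 4 v x
  + 420 * deriv v x * iteratedDeriv 2 v x * iteratedDeriv 3 v x
  + 420 * (deriv v x) ^ 3 * iteratedDeriv 2 v x
/-- The resonance polynomial of the first Painlevé branch (`u₀ = 2φₓ`). -/
def R1 (j : ℝ) : ℝ :=
  (j + 1) * (j - 1) * (j - 2) * (j - 3) * (j - 4) * (j - 5) * (j - 8) * (j - 14)

/-- The `k`-th derivative of `ξ ↦ 2 / ξ + s * ξ ^ r` at a positive point. -/
theorem iteratedDeriv_two_div_add_mul_rpow (k : ℕ) (s r : ℝ) {x : ℝ} (hx : 0 < x) :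
    iteratedDeriv k (fun ξ : ℝ => 2 / ξ + s * ξ ^ r) x
      = 2 * ((-1) ^ k * k.factorial) / x ^ (k + 1)
        + s * ((descPochhammer ℝ k).eval r * x ^ r / x ^ k) := by
  have hinv : ContDiffAt ℝ k (fun ξ : ℝ => 2 * ξ⁻¹) x :=
    contDiffAt_const.mul (contDiffAt_inv ℝ hx.ne')
  have hrpow : ContDiffAt ℝ k (fun ξ : ℝ => s * ξ ^ r) x :=
    contDiffAt_const.mul (Real.contDiffAt_rpow_const_of_ne hx.ne')
  have hzpow : x ^ (-1 - k : ℤ) = (x ^ (k + 1))⁻¹ := by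
    rw [← zpow_natCast, ← zpow_neg]
    congr 1
    push_cast
    ring
  simp only [div_eq_mul_inv (2 : ℝ)]
  rw [iteratedDeriv_fun_add hinv hrpow, iteratedDeriv_const_mul_field,
    iteratedDeriv_const_mul_field, iteratedDeriv_eq_iterate, iteratedDeriv_eq_iterate,
    Real.iter_deriv_rpow_const, Real.rpow_sub hx, Real.rpow_natCast,
    iter_deriv_inv, hzpow]
  ring

/-- The linearization of the polynomial expression defining `F0`, along affine variations
`c k + s * d k` of the derivatives. -/
theorem hasDerivAt_F0_of_affine {v : ℝ → ℝ → ℝ} {x : ℝ} {c d : ℕ → ℝ}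
    (hv : ∀ s k, iteratedDeriv k (v s) x = c k + s * d k) :
    HasDerivAt (fun s => F0 (v s) x)
      (d 8 + 28 * (d 1 * c 6 + c 1 * d 6) + 28 * (d 2 * c 5 + c 2 * d 5)
        + 70 * (d 3 * c 4 + c 3 * d 4)
        + 210 * (2 * c 1 * d 1 * c 4 + c 1 ^ 2 * d 4)
        + 420 * (d 1 * c 2 * c 3 + c 1 * d 2 * c 3 + c 1 * c 2 * d 3)
        + 420 * (3 * c 1 ^ 2 * d 1 * c 2 + c 1 ^ 3 * d 2)) 0 := by
  have h (k : ℕ) : HasDerivAt (fun s : ℝ => c k + s * d k) (d k) 0 := by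
    simpa using ((hasDerivAt_id (0 : ℝ)).mul_const (d k)).const_add (c k)
  simp only [F0, ← iteratedDeriv_one, hv]
  refine (((((((h 8).fun_add (((h 1).const_mul 28).fun_mul (h 6))).fun_add
    (((h 2).const_mul 28).fun_mul (h 5))).fun_add
    (((h 3).const_mul 70).fun_mul (h 4))).fun_add
    ((((h 1).fun_pow 2).const_mul 210).fun_mul (h 4))).fun_add
    ((((h 1).const_mul 420).fun_mul (h 2)).fun_mul (h 3))).fun_add
    ((((h 1).fun_pow 3).const_mul 420).fun_mul (h 2))).congr_deriv ?_
  simp only [zero_mul, add_zero]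
  push_cast
  ring

/-- First Painlevé branch: linearizing `F₀` around `ξ ↦ 2/ξ` with perturbation
`ξ^{j−1}` gives `R₁(j)·x^{j−9}`, so the resonance points are exactly
`j = −1, 1, 2, 3, 4, 5, 8, 14`. -/
theorem first_branch_resonances :
    (∀ (j : ℝ) (x : ℝ), 0 < x →
      deriv (fun s : ℝ => F0 (fun ξ => 2 / ξ + s * ξ ^ (j - 1)) x) 0
        = R1 j * x ^ (j - 9)) ∧
    (∀ j : ℝ, R1 j = 0 ↔
      (j = -1 ∨ j = 1 ∨ j = 2 ∨ j = 3 ∨ j = 4 ∨ j = 5 ∨ j = 8 ∨ j = 14)) := by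
  refine ⟨fun j x hx => ?_, fun j => ?_⟩
  · have hpow : x ^ (j - 9) = x ^ (j - 1) / x ^ 8 := by
      rw [← Real.rpow_sub_natCast hx.ne']
      congr 1
      push_cast
      ring
    rw [(hasDerivAt_F0_of_affine
      fun s k => iteratedDeriv_two_div_add_mul_rpow k s (j - 1) hx).deriv, hpow]
    simp only [descPochhammer_eval_eq_prod_range, Finset.prod_range_succ, Finset.prod_range_zero,
      Nat.factorial, R1]
    generalize x ^ (j - 1) = y
    field_simp
    push_cast
    ring
  · simp only [R1, mul_eq_zero, sub_eq_zero, add_eq_zero_iff_eq_neg, or_assoc]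

end
end

section
/- Second Painlevé branch resonances: for every j ∈ ℝ and every x > 0, the derivative at s = 0 of the map s ↦ F₀[ξ ↦ 4/ξ + s·ξ^{j−1}](x) equals R₂(j)·x^{j−9}, where R₂(j) = (j+2)(j+1)(j−1)(j−2)(j−3)(j−8)(j² − 25j + 140). In particular the resonance points of the branch with leading coefficient u₀ = 4φₓ are exactly j = −2, −1, 1, 2, 3, 8, (25+√65)/2, (25−√65)/2. -/
noncomputable section

/-- The resonance polynomial of the second Painlevé branch (`u₀ = 4φₓ`). -/
def R2 (j : ℝ) : ℝ :=
  (j + 2) * (j + 1) * (j - 1) * (j - 2) * (j - 3) * (j - 8) * (j ^ 2 - 25 * j + 140)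

/-- Derivatives on the positive half-line of a perturbed simple pole. -/
lemma iteratedDeriv_pole_add_rpow (c s a : ℝ) (k : ℕ) {x : ℝ} (hx : 0 < x) :
    iteratedDeriv k (fun ξ : ℝ => c / ξ + s * ξ ^ a) x
      = c * ((-1) ^ k * k.factorial * (x⁻¹) ^ (k + 1))
        + s * ((descPochhammer ℝ k).eval a * (x ^ a * (x⁻¹) ^ k)) := by
  have hpole : ContDiffAt ℝ k (fun ξ : ℝ => c * ξ⁻¹) x :=
    contDiffAt_const.mul (contDiffAt_inv ℝ hx.ne')
  have hpow : ContDiffAt ℝ k (fun ξ : ℝ => s * ξ ^ a) x :=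
    contDiffAt_const.mul (Real.contDiffAt_rpow_const_of_ne hx.ne')
  simp only [div_eq_mul_inv]
  rw [iteratedDeriv_fun_add hpole hpow, iteratedDeriv_const_mul_field,
    iteratedDeriv_const_mul_field, iteratedDeriv_eq_iterate, iteratedDeriv_eq_iterate,
    Real.iter_deriv_rpow_const, iter_deriv_inv, Real.rpow_sub_natCast hx.ne',
    div_eq_mul_inv, inv_pow, inv_pow, show (-1 - k : ℤ) = -((k + 1 : ℕ) : ℤ) by push_cast; ring,
    zpow_neg, zpow_natCast]

/-- Second Painlevé branch: linearizing `F₀` around `ξ ↦ 4/ξ` with perturbation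
`ξ^{j−1}` gives `R₂(j)·x^{j−9}`, so the resonance points are exactly
`j = −2, −1, 1, 2, 3, 8, (25±√65)/2`. -/
theorem second_branch_resonances :
    (∀ (j : ℝ) (x : ℝ), 0 < x →
      deriv (fun s : ℝ => F0 (fun ξ => 4 / ξ + s * ξ ^ (j - 1)) x) 0
        = R2 j * x ^ (j - 9)) ∧
    (∀ j : ℝ, R2 j = 0 ↔
      (j = -2 ∨ j = -1 ∨ j = 1 ∨ j = 2 ∨ j = 3 ∨ j = 8 ∨
        j = (25 + Real.sqrt 65) / 2 ∨ j = (25 - Real.sqrt 65) / 2)) := by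
  refine ⟨fun j x hx => ?_, fun j => ?_⟩
  · have hexp : x ^ (j - 9) = x ^ (j - 1) * (x⁻¹) ^ 8 := by
      rw [show j - 9 = j - 1 - (8 : ℕ) by push_cast; ring, Real.rpow_sub_natCast hx.ne',
        div_eq_mul_inv, inv_pow]
    simp only [F0, ← iteratedDeriv_one, iteratedDeriv_pole_add_rpow 4 _ _ _ hx, hexp]
    rw [iteratedDeriv_one]
    generalize x ^ (j - 1) = p
    generalize x⁻¹ = y
    have hlin (A B : ℝ) : HasDerivAt (fun s : ℝ => A + s * B) B 0 := by
      simpa using ((hasDerivAt_id (0 : ℝ)).mul_const B).const_add A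
    set A : ℕ → ℝ := fun k => 4 * ((-1) ^ k * k.factorial * y ^ (k + 1)) with hA
    set B : ℕ → ℝ := fun k => (descPochhammer ℝ k).eval (j - 1) * (p * y ^ k) with hB
    have h (k : ℕ) : HasDerivAt (fun s : ℝ => A k + s * B k) (B k) 0 := hlin _ _
    have key := (((((((h 8).add (((h 1).const_mul 28).mul (h 6))).add
      (((h 2).const_mul 28).mul (h 5))).add (((h 3).const_mul 70).mul (h 4))).add
      ((((h 1).pow 2).const_mul 210).mul (h 4))).add
      ((((h 1).const_mul 420).mul (h 2)).mul (h 3))).add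
      ((((h 1).pow 3).const_mul 420).mul (h 2)))
    refine key.deriv.trans ?_
    simp only [hA, hB, R2, descPochhammer_succ_eval, descPochhammer_zero, Polynomial.eval_one,
      Nat.factorial, Pi.mul_apply, Pi.pow_apply]
    push_cast
    ring
  · have h65 : Real.sqrt 65 ^ 2 = 65 := Real.sq_sqrt (by norm_num)
    have hfac : R2 j = (j - -2) * (j - -1) * (j - 1) * (j - 2) * (j - 3) * (j - 8) *
        (j - (25 + Real.sqrt 65) / 2) * (j - (25 - Real.sqrt 65) / 2) := by
      unfold R2
      linear_combination ((1 / 4) * (j + 2) * (j + 1) * (j - 1) * (j - 2) * (j - 3) * (j - 8)) * h65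
    simp only [hfac, mul_eq_zero, sub_eq_zero, or_assoc]

end
end

section
/- Third Painlevé branch resonances: for every j ∈ ℝ and every x > 0, the derivative at s = 0 of the map s ↦ F₀[ξ ↦ 6/ξ + s·ξ^{j−1}](x) equals R₃(j)·x^{j−9}, where R₃(j) = (j+3)(j+2)(j+1)(j−1)(j−8)(j−10)(j² − 23j + 84). In particular the resonance points of the branch with leading coefficient u₀ = 6φₓ are exactly j = −3, −2, −1, 1, 8, 10, (23+√193)/2, (23−√193)/2. -/
noncomputable section

/-- The resonance polynomial of the third Painlevé branch (`u₀ = 6φₓ`). -/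
def R3 (j : ℝ) : ℝ :=
  (j + 3) * (j + 2) * (j + 1) * (j - 1) * (j - 8) * (j - 10) * (j ^ 2 - 23 * j + 84)

/-- `F₀` as a polynomial in the derivatives `a k = v⁽ᵏ⁾(x)`. -/
def F0Jet (a : ℕ → ℝ) : ℝ :=
  a 8 + 28 * a 1 * a 6 + 28 * a 2 * a 5 + 70 * a 3 * a 4 + 210 * a 1 ^ 2 * a 4
    + 420 * a 1 * a 2 * a 3 + 420 * a 1 ^ 3 * a 2

/-- The `k`-th derivative of `ξ ↦ 6 / ξ` at `x`. -/
def leadingJet (x : ℝ) (k : ℕ) : ℝ :=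
  6 * ((-1) ^ k * k.factorial / x ^ (k + 1))

/-- The `k`-th derivative of `ξ ↦ ξ ^ (j - 1)` at `x`. -/
def perturbationJet (j x : ℝ) (k : ℕ) : ℝ :=
  (descPochhammer ℝ k).eval (j - 1) * x ^ (j - 1 - k)

lemma iteratedDeriv_leading_add_perturbation (j s : ℝ) {x : ℝ} (hx : 0 < x) (k : ℕ) :
    iteratedDeriv k (fun ξ : ℝ => 6 / ξ + s * ξ ^ (j - 1)) x
      = leadingJet x k + s * perturbationJet j x k := by
  have hinv : ContDiffAt ℝ k (fun ξ : ℝ => 6 / ξ) x :=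
    contDiffAt_const.div contDiffAt_id hx.ne'
  have hrpow : ContDiffAt ℝ k (fun ξ : ℝ => s * ξ ^ (j - 1)) x :=
    contDiffAt_const.mul (Real.contDiffAt_rpow_const_of_ne hx.ne')
  have hiter : iteratedDeriv k (fun ξ : ℝ => ξ⁻¹) x = (-1) ^ k * k.factorial / x ^ (k + 1) := by
    rw [iteratedDeriv_eq_iterate, div_eq_mul_inv, ← zpow_natCast x, ← zpow_neg]
    convert iter_deriv_inv k x using 2
    push_cast
    ring_nf
  rw [iteratedDeriv_fun_add hinv hrpow, iteratedDeriv_const_mul_field]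
  simp only [div_eq_mul_inv (6 : ℝ)]
  rw [iteratedDeriv_const_mul_field, hiter, iteratedDeriv_eq_iterate,
    Real.iter_deriv_rpow_const, leadingJet, perturbationJet]

lemma deriv_F0Jet_line (a b : ℕ → ℝ) :
    deriv (fun s : ℝ => F0Jet fun k => a k + s * b k) 0
      = b 8 + 28 * (b 1 * a 6 + a 1 * b 6) + 28 * (b 2 * a 5 + a 2 * b 5)
        + 70 * (b 3 * a 4 + a 3 * b 4) + 210 * (2 * a 1 * b 1 * a 4 + a 1 ^ 2 * b 4)
        + 420 * (b 1 * a 2 * a 3 + a 1 * b 2 * a 3 + a 1 * a 2 * b 3)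
        + 420 * (3 * a 1 ^ 2 * b 1 * a 2 + a 1 ^ 3 * b 2) := by
  have h (k : ℕ) : HasDerivAt (fun s : ℝ => a k + s * b k) (b k) 0 := by
    simpa using ((hasDerivAt_id (0 : ℝ)).mul_const (b k)).const_add (a k)
  have hline := ((((((h 8).add (((h 1).const_mul 28).mul (h 6))).add
    (((h 2).const_mul 28).mul (h 5))).add (((h 3).const_mul 70).mul (h 4))).add
    ((((h 1).pow 2).const_mul 210).mul (h 4))).add
    ((((h 1).const_mul 420).mul (h 2)).mul (h 3))).add ((((h 1).pow 3).const_mul 420).mul (h 2))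
  refine hline.deriv.trans ?_
  simp only [Pi.mul_apply, Pi.pow_apply, Nat.cast_ofNat, Nat.add_one_sub_one, zero_mul, add_zero]
  ring

lemma R3_eq_zero_iff (j : ℝ) :
    R3 j = 0 ↔
      (j = -3 ∨ j = -2 ∨ j = -1 ∨ j = 1 ∨ j = 8 ∨ j = 10 ∨
        j = (23 + Real.sqrt 193) / 2 ∨ j = (23 - Real.sqrt 193) / 2) := by
  have hquad : j ^ 2 - 23 * j + 84
      = (j - (23 + Real.sqrt 193) / 2) * (j - (23 - Real.sqrt 193) / 2) := by
    linear_combination (1 / 4 : ℝ) * Real.sq_sqrt (show (0 : ℝ) ≤ 193 by norm_num)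
  simp only [R3, hquad, mul_eq_zero, sub_eq_zero, add_eq_zero_iff_eq_neg, or_assoc]

/-- Third Painlevé branch: linearizing `F₀` around `ξ ↦ 6/ξ` with perturbation
`ξ^{j−1}` gives `R₃(j)·x^{j−9}`, so the resonance points are exactly
`j = −3, −2, −1, 1, 8, 10, (23±√193)/2`. -/
theorem third_branch_resonances :
    (∀ (j : ℝ) (x : ℝ), 0 < x →
      deriv (fun s : ℝ => F0 (fun ξ => 6 / ξ + s * ξ ^ (j - 1)) x) 0
        = R3 j * x ^ (j - 9)) ∧
    (∀ j : ℝ, R3 j = 0 ↔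
      (j = -3 ∨ j = -2 ∨ j = -1 ∨ j = 1 ∨ j = 8 ∨ j = 10 ∨
        j = (23 + Real.sqrt 193) / 2 ∨ j = (23 - Real.sqrt 193) / 2)) := by
  refine ⟨fun j x hx => ?_, R3_eq_zero_iff⟩
  have hF : (fun s : ℝ => F0 (fun ξ => 6 / ξ + s * ξ ^ (j - 1)) x) = fun s =>
      F0Jet fun k => leadingJet x k + s * perturbationJet j x k := by
    funext s
    simp only [F0, F0Jet, ← iteratedDeriv_one, iteratedDeriv_leading_add_perturbation j s hx]
  have hpow (k i : ℕ) (hki : k + i = 8) : x ^ (j - 1 - k) = x ^ (j - 9) * x ^ i := by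
    rw [← Real.rpow_natCast x i, ← Real.rpow_add hx]
    congr 1
    have : (k : ℝ) + i = 8 := mod_cast hki
    linarith
  rw [hF, deriv_F0Jet_line]
  simp only [leadingJet, perturbationJet, hpow 1 7 rfl, hpow 2 6 rfl, hpow 3 5 rfl, hpow 4 4 rfl,
    hpow 5 3 rfl, hpow 6 2 rfl, hpow 8 0 rfl, descPochhammer_eval_eq_prod_range,
    Finset.prod_range_succ, Finset.prod_range_zero, Nat.factorial, R3]
  generalize x ^ (j - 9) = y
  push_cast
  field_simp
  ring

end
end
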